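/- arXiv:1509.04698 — 2 statements merged into one kernel-verified Lean document; each statement's English description precedes it below -/
import Mathlib

section
/- A feasible rate policy r = (r_1,…,r_N) is optimal if and only if it is the recursively defined water-filling policy: there exist indices 0 = i_0 < i_1 < ⋯ < i_M = N such that for every n = 1,…,M, defining for i_{n−1} < i ≤ N the value v_n(i) := min{ g( (∑_{j=1}^{i} E_j − ∑_{j=1}^{i_{n−1}} f(r_j)) / (i − i_{n−1}) ), ψ( (∑_{j=1}^{i} Ē_j − ∑_{j=1}^{i_{n−1}} φ(r_j)) / (i − i_{n−1}) ) }, the index i_n minimizes v_n(i) over i ∈ {i_{n−1}+1,…,N}, and r_j = v_n(i_n) for all j with i_{n−1} < j ≤ i_n. -/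
open Finset

/-- The rate function `g(p) = (1/2)·log₂(1+p)`. -/
noncomputable def gfun (p : ℝ) : ℝ := Real.logb 2 (1 + p) / 2

/-- The rate-to-power function `f(r) = 2^{2r} − 1` (inverse of `gfun`). -/
noncomputable def ffun (r : ℝ) : ℝ := (2 : ℝ) ^ (2 * r) - 1

/-- A rate policy `r` is feasible for the single-user energy harvesting channel with
transmitter energies `E`, receiver energies `Ebar` and decoding cost function `φ`. -/
def SUFeasible (N : ℕ) (E Ebar : ℕ → ℝ) (φ : ℝ → ℝ) (r : ℕ → ℝ) : Prop :=
  (∀ i ∈ Finset.Icc 1 N, 0 ≤ r i) ∧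
  (∀ k ∈ Finset.Icc 1 N,
      ∑ i ∈ Finset.Icc 1 k, ffun (r i) ≤ ∑ i ∈ Finset.Icc 1 k, E i) ∧
  (∀ k ∈ Finset.Icc 1 N,
      ∑ i ∈ Finset.Icc 1 k, φ (r i) ≤ ∑ i ∈ Finset.Icc 1 k, Ebar i)

/-- The water-filling candidate value `v_n(i)` for a rate starting after slot `m = i_{n-1}`:
the minimum of the transmitter-side and the receiver-side equalized levels. -/
noncomputable def vval (E Ebar : ℕ → ℝ) (φ ψ : ℝ → ℝ) (r : ℕ → ℝ) (m i : ℕ) : ℝ :=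
  min
    (gfun ((∑ j ∈ Finset.Icc 1 i, E j - ∑ j ∈ Finset.Icc 1 m, ffun (r j)) /
      ((i : ℝ) - (m : ℝ))))
    (ψ ((∑ j ∈ Finset.Icc 1 i, Ebar j - ∑ j ∈ Finset.Icc 1 m, φ (r j)) /
      ((i : ℝ) - (m : ℝ))))

/-- A cost function together with its inverse and strict subgradients. -/
structure GoodCost (h k : ℝ → ℝ) : Prop where
  mono : StrictMonoOn h (Set.Ici 0)
  zero : h 0 = 0
  inv : ∀ y : ℝ, 0 ≤ y → h (k y) = y
  inv_nonneg : ∀ y : ℝ, 0 ≤ y → 0 ≤ k y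
  sub : ∃ s : ℝ → ℝ, ∀ x y : ℝ, 0 ≤ x → 0 ≤ y → y ≠ x → h x + s x * (y - x) < h y

lemma GoodCost.le_iff {h k : ℝ → ℝ} (H : GoodCost h k) {c y : ℝ} (hc : 0 ≤ c) (hy : 0 ≤ y) :
    c ≤ k y ↔ h c ≤ y := by
  have := H.mono.le_iff_le (a := c) (b := k y) hc (H.inv_nonneg y hy)
  rw [H.inv y hy] at this
  exact this.symm

lemma goodCost_ffun : GoodCost ffun gfun := by
  have hl : (0 : ℝ) < Real.log 2 := Real.log_pos (by norm_num)
  have hexp : ∀ r : ℝ, ffun r = Real.exp (Real.log 2 * (2 * r)) - 1 := by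
    intro r
    rw [ffun, Real.rpow_def_of_pos (by norm_num)]
  refine ⟨?_, ?_, ?_, ?_, ?_⟩
  · intro x _ y _ hxy
    rw [hexp, hexp]
    have : Real.exp (Real.log 2 * (2 * x)) < Real.exp (Real.log 2 * (2 * y)) := by
      apply Real.exp_lt_exp.2
      nlinarith
    linarith
  · simp [ffun]
  · intro y hy
    have h1 : (0 : ℝ) < 1 + y := by linarith
    have h2 : 2 * gfun y = Real.logb 2 (1 + y) := by rw [gfun]; ring
    rw [ffun, h2, Real.rpow_logb (by norm_num) (by norm_num) h1]
    ring
  · intro y hy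
    rw [gfun]
    have := Real.logb_nonneg (b := 2) (x := 1 + y) (by norm_num) (by linarith)
    linarith
  · refine ⟨fun x => Real.exp (Real.log 2 * (2 * x)) * (Real.log 2 * 2), ?_⟩
    intro x y _ _ hxy
    rw [hexp, hexp]
    have hne : Real.log 2 * 2 * (y - x) ≠ 0 :=
      mul_ne_zero (by positivity) (sub_ne_zero.2 hxy)
    have h1 := Real.add_one_lt_exp hne
    have h2 : Real.exp (Real.log 2 * (2 * y)) =
        Real.exp (Real.log 2 * (2 * x)) * Real.exp (Real.log 2 * 2 * (y - x)) := by
      rw [← Real.exp_add]; congr 1; ring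
    have h3 := Real.exp_pos (Real.log 2 * (2 * x))
    rw [h2]
    nlinarith

lemma goodCost_phi (φ ψ : ℝ → ℝ)
    (hphi_mono : StrictMonoOn φ (Set.Ici 0))
    (hphi_conv : StrictConvexOn ℝ (Set.Ici 0) φ)
    (hphi0 : φ 0 = 0)
    (hpsi_right : ∀ y : ℝ, 0 ≤ y → φ (ψ y) = y)
    (hpsi_nonneg : ∀ y : ℝ, 0 ≤ y → 0 ≤ ψ y) : GoodCost φ ψ := by
  refine ⟨hphi_mono, hphi0, hpsi_right, hpsi_nonneg, ?_⟩
  have key : ∀ x : ℝ, ∃ s : ℝ, 0 ≤ x → ∀ y : ℝ, 0 ≤ y → y ≠ x → φ x + s * (y - x) < φ y := by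
    intro x
    by_cases hx : 0 ≤ x
    swap
    · exact ⟨0, fun h => absurd h hx⟩
    rcases hx.eq_or_lt with rfl | hx
    · refine ⟨0, fun _ y hy hne => ?_⟩
      have := hphi_mono (a := 0) (b := y) (by simp) hy (lt_of_le_of_ne hy (Ne.symm hne))
      linarith
    have hL : ((fun y => (φ x - φ y) / (x - y)) '' Set.Ico 0 x).Nonempty :=
      ⟨_, 0, ⟨le_refl _, hx⟩, rfl⟩
    have hU : ((fun z => (φ z - φ x) / (z - x)) '' Set.Ioi x).Nonempty :=
      ⟨_, x + 1, by simp, rfl⟩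
    obtain ⟨s, hs1, hs2⟩ : ∃ s, (∀ y, 0 ≤ y → y < x → (φ x - φ y) / (x - y) ≤ s) ∧
        (∀ z, x < z → s ≤ (φ z - φ x) / (z - x)) := by
      obtain ⟨s, h1, h2⟩ := exists_between_of_forall_le hL hU (by
        rintro _ ⟨y, hy, rfl⟩ _ ⟨z, hz, rfl⟩
        have hz' : x < z := hz
        exact (hphi_conv.slope_strict_mono_adjacent (x := y) (y := x) (z := z) hy.1
          (le_trans hx.le hz'.le) hy.2 hz').le)
      exact ⟨s, fun y h0 hy => h1 ⟨y, ⟨h0, hy⟩, rfl⟩, fun z hz => h2 ⟨z, hz, rfl⟩⟩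
    have weak : ∀ y : ℝ, 0 ≤ y → φ x + s * (y - x) ≤ φ y := by
      intro y hy
      rcases lt_trichotomy y x with h | h | h
      · have := hs1 y hy h
        rw [div_le_iff₀ (by linarith)] at this
        linarith
      · subst h; simp
      · have := hs2 y h
        rw [le_div_iff₀ (by linarith)] at this
        linarith
    refine ⟨s, fun _ y hy hne => ?_⟩
    have h1 := hphi_conv.2 (show x ∈ Set.Ici (0 : ℝ) from hx.le)
      (show y ∈ Set.Ici (0 : ℝ) from hy) hne.symm (by norm_num : (0 : ℝ) < 1 / 2)
      (by norm_num : (0 : ℝ) < 1 / 2) (by norm_num)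
    simp only [smul_eq_mul] at h1
    have h2 := weak (1 / 2 * x + 1 / 2 * y) (by positivity)
    nlinarith
  choose s hs using key
  exact ⟨s, fun x y hx hy hne => hs x hx y hy hne⟩

lemma sum_block (h : ℝ → ℝ) (r : ℕ → ℝ) (c : ℝ) (m i : ℕ) (hmi : m ≤ i)
    (hr : ∀ j, m < j → j ≤ i → r j = c) :
    ∑ j ∈ Finset.Icc 1 i, h (r j) = ∑ j ∈ Finset.Icc 1 m, h (r j) + ((i : ℝ) - m) * h c := by
  induction i, hmi using Nat.le_induction with
  | base => simp
  | succ i hi ih =>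
    rw [Finset.sum_Icc_succ_top (by omega), ih (fun j h1 h2 => hr j h1 (by omega)),
      hr (i + 1) (by omega) le_rfl]
    push_cast
    ring

/-- Data of the problem. -/
structure Prob (N : ℕ) (E Ebar : ℕ → ℝ) (φ ψ : ℝ → ℝ) : Prop where
  hE : ∀ i ∈ Finset.Icc 1 N, 0 ≤ E i
  hEbar : ∀ i ∈ Finset.Icc 1 N, 0 ≤ Ebar i
  hphi : GoodCost φ ψ

lemma avail_nonneg (N : ℕ) (E : ℕ → ℝ) (hE : ∀ i ∈ Finset.Icc 1 N, 0 ≤ E i) (h : ℝ → ℝ)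
    (r : ℕ → ℝ) (m i : ℕ) (hmi : m ≤ i) (hiN : i ≤ N)
    (hf : ∀ k ∈ Finset.Icc 1 m, ∑ j ∈ Finset.Icc 1 k, h (r j) ≤ ∑ j ∈ Finset.Icc 1 k, E j) :
    0 ≤ ∑ j ∈ Finset.Icc 1 i, E j - ∑ j ∈ Finset.Icc 1 m, h (r j) := by
  have h1 : ∑ j ∈ Finset.Icc 1 m, E j ≤ ∑ j ∈ Finset.Icc 1 i, E j := by
    apply Finset.sum_le_sum_of_subset_of_nonneg
    · exact Finset.Icc_subset_Icc le_rfl hmi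
    · intro j hj _
      simp only [Finset.mem_Icc] at hj
      exact hE j (Finset.mem_Icc.2 (by omega))
  have h2 : ∑ j ∈ Finset.Icc 1 m, h (r j) ≤ ∑ j ∈ Finset.Icc 1 m, E j := by
    rcases Nat.eq_zero_or_pos m with rfl | hm
    · simp
    · exact hf m (Finset.mem_Icc.2 ⟨hm, le_rfl⟩)
  linarith

section
variable {N : ℕ} {E Ebar : ℕ → ℝ} {φ ψ : ℝ → ℝ}

lemma le_vval_iff (P : Prob N E Ebar φ ψ) {r : ℕ → ℝ} {m i : ℕ} (hmi : m < i) (hiN : i ≤ N)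
    (hf : SUFeasible m E Ebar φ r) {c : ℝ} (hc : 0 ≤ c) :
    c ≤ vval E Ebar φ ψ r m i ↔
      (∑ j ∈ Finset.Icc 1 m, ffun (r j) + ((i : ℝ) - m) * ffun c ≤ ∑ j ∈ Finset.Icc 1 i, E j) ∧
      (∑ j ∈ Finset.Icc 1 m, φ (r j) + ((i : ℝ) - m) * φ c ≤ ∑ j ∈ Finset.Icc 1 i, Ebar j) := by
  have hd : (0 : ℝ) < (i : ℝ) - m := by
    have : (m : ℝ) < i := by exact_mod_cast hmi
    linarith
  have hA := avail_nonneg N E P.hE ffun r m i hmi.le hiN hf.2.1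
  have hB := avail_nonneg N Ebar P.hEbar φ r m i hmi.le hiN hf.2.2
  rw [vval, le_min_iff, goodCost_ffun.le_iff hc (div_nonneg hA hd.le),
    P.hphi.le_iff hc (div_nonneg hB hd.le), le_div_iff₀ hd, le_div_iff₀ hd]
  constructor
  · rintro ⟨h1, h2⟩; constructor <;> linarith
  · rintro ⟨h1, h2⟩; constructor <;> linarith

lemma vval_nonneg (P : Prob N E Ebar φ ψ) {r : ℕ → ℝ} {m i : ℕ} (hmi : m < i) (hiN : i ≤ N)
    (hf : SUFeasible m E Ebar φ r) : 0 ≤ vval E Ebar φ ψ r m i := by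
  rw [le_vval_iff P hmi hiN hf le_rfl, goodCost_ffun.zero, P.hphi.zero]
  have hA := avail_nonneg N E P.hE ffun r m i hmi.le hiN hf.2.1
  have hB := avail_nonneg N Ebar P.hEbar φ r m i hmi.le hiN hf.2.2
  constructor <;> linarith

lemma vval_tight (P : Prob N E Ebar φ ψ) {r : ℕ → ℝ} {m i : ℕ} (hmi : m < i) (hiN : i ≤ N)
    (hf : SUFeasible m E Ebar φ r) :
    (∑ j ∈ Finset.Icc 1 m, ffun (r j) + ((i : ℝ) - m) * ffun (vval E Ebar φ ψ r m i)
        = ∑ j ∈ Finset.Icc 1 i, E j) ∨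
      (∑ j ∈ Finset.Icc 1 m, φ (r j) + ((i : ℝ) - m) * φ (vval E Ebar φ ψ r m i)
        = ∑ j ∈ Finset.Icc 1 i, Ebar j) := by
  have hd : (0 : ℝ) < (i : ℝ) - m := by
    have : (m : ℝ) < i := by exact_mod_cast hmi
    linarith
  have hA := avail_nonneg N E P.hE ffun r m i hmi.le hiN hf.2.1
  have hB := avail_nonneg N Ebar P.hEbar φ r m i hmi.le hiN hf.2.2
  rw [vval]
  rcases min_choice (gfun ((∑ j ∈ Finset.Icc 1 i, E j - ∑ j ∈ Finset.Icc 1 m, ffun (r j)) /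
      ((i : ℝ) - (m : ℝ)))) (ψ ((∑ j ∈ Finset.Icc 1 i, Ebar j - ∑ j ∈ Finset.Icc 1 m, φ (r j)) /
      ((i : ℝ) - (m : ℝ)))) with h | h
  · left
    rw [h, goodCost_ffun.inv _ (div_nonneg hA hd.le)]
    field_simp
    ring
  · right
    rw [h, P.hphi.inv _ (div_nonneg hB hd.le)]
    field_simp
    ring

lemma SUFeasible.restrict {r : ℕ → ℝ} {m : ℕ} (hmN : m ≤ N) (hf : SUFeasible N E Ebar φ r) :
    SUFeasible m E Ebar φ r := by
  have hs : Finset.Icc 1 m ⊆ Finset.Icc 1 N := Finset.Icc_subset_Icc le_rfl hmN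
  exact ⟨fun i hi => hf.1 i (hs hi), fun i hi => hf.2.1 i (hs hi), fun i hi => hf.2.2 i (hs hi)⟩

/-- `WF N E Ebar φ ψ r m`: the policy `r` is water-filling up to slot `m`, a breakpoint. -/
inductive WF (N : ℕ) (E Ebar : ℕ → ℝ) (φ ψ : ℝ → ℝ) (r : ℕ → ℝ) : ℕ → Prop
  | zero : WF N E Ebar φ ψ r 0
  | step (m i : ℕ) (hm : WF N E Ebar φ ψ r m) (hmi : m < i) (hiN : i ≤ N)
      (hmin : ∀ k, m < k → k ≤ N → vval E Ebar φ ψ r m i ≤ vval E Ebar φ ψ r m k)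
      (hr : ∀ j, m < j → j ≤ i → r j = vval E Ebar φ ψ r m i) : WF N E Ebar φ ψ r i

/-- One tight generic constraint yields the comparison. -/
lemma compare {h k : ℝ → ℝ} (H : GoodCost h k) (r r' : ℕ → ℝ) (m i : ℕ) (c : ℝ) (hc : 0 ≤ c)
    (hmi : m ≤ i) (hr : ∀ j, m < j → j ≤ i → r j = c)
    (hr0 : ∀ j ∈ Finset.Icc 1 i, 0 ≤ r j) (hr'0 : ∀ j ∈ Finset.Icc 1 i, 0 ≤ r' j)
    (hle : ∀ j ∈ Finset.Icc 1 m, r j ≤ c)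
    (hD : ∀ s : ℝ → ℝ, MonotoneOn s (Set.Ici 0) →
      s c * ∑ j ∈ Finset.Icc 1 m, (r' j - r j) ≤ ∑ j ∈ Finset.Icc 1 m, s (r j) * (r' j - r j))
    (hsum : ∑ j ∈ Finset.Icc 1 i, h (r' j) ≤ ∑ j ∈ Finset.Icc 1 i, h (r j)) :
    ∑ j ∈ Finset.Icc 1 i, (r' j - r j) ≤ 0 ∧
      (∑ j ∈ Finset.Icc 1 i, (r' j - r j) = 0 → ∀ j ∈ Finset.Icc 1 i, r' j = r j) := by
  have hle' : ∀ j ∈ Finset.Icc 1 i, r j ≤ c := by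
    intro j hj
    rw [Finset.mem_Icc] at hj
    by_cases hjm : j ≤ m
    · exact hle j (Finset.mem_Icc.2 ⟨hj.1, hjm⟩)
    · exact (hr j (by omega) hj.2).le
  rcases hc.eq_or_lt with rfl | hcpos
  · have hz : ∀ j ∈ Finset.Icc 1 i, r j = 0 := fun j hj => le_antisymm (hle' j hj) (hr0 j hj)
    have hs0 : ∑ j ∈ Finset.Icc 1 i, h (r j) = 0 :=
      Finset.sum_eq_zero (fun j hj => by rw [hz j hj, H.zero])
    have hnn : ∀ j ∈ Finset.Icc 1 i, 0 ≤ h (r' j) := by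
      intro j hj
      have := H.mono.monotoneOn (a := 0) (b := r' j) (by simp) (hr'0 j hj) (hr'0 j hj)
      rwa [H.zero] at this
    have hz' : ∀ j ∈ Finset.Icc 1 i, h (r' j) = 0 :=
      (Finset.sum_eq_zero_iff_of_nonneg hnn).1
        (le_antisymm (by rw [← hs0]; exact hsum) (Finset.sum_nonneg hnn))
    have heq : ∀ j ∈ Finset.Icc 1 i, r' j = r j := by
      intro j hj
      rw [hz j hj]
      apply H.mono.injOn (hr'0 j hj) (by simp : (0 : ℝ) ∈ Set.Ici 0)
      rw [hz' j hj, H.zero]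
    refine ⟨?_, fun _ => heq⟩
    exact (Finset.sum_eq_zero (fun j hj => by rw [heq j hj]; ring)).le
  · obtain ⟨s, hs⟩ := H.sub
    have hsm : MonotoneOn s (Set.Ici 0) := by
      intro x hx y hy hxy
      rcases hxy.eq_or_lt with rfl | hlt
      · exact le_rfl
      have h1 := hs x y hx hy hlt.ne'
      have h2 := hs y x hy hx hlt.ne
      by_contra hcon
      push Not at hcon
      nlinarith
    have hsc : 0 < s c := by
      have h1 := hs c 0 hc le_rfl hcpos.ne
      have h2 := H.mono (a := 0) (b := c) (by simp) hc hcpos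
      by_contra hcon
      push Not at hcon
      nlinarith
    have hAb : s c * ∑ j ∈ Finset.Icc 1 i, (r' j - r j) ≤
        ∑ j ∈ Finset.Icc 1 i, s (r j) * (r' j - r j) := by
      clear hsum hle' hr0 hr'0
      induction i, hmi using Nat.le_induction with
      | base => exact hD s hsm
      | succ i hi ih =>
        have := ih (fun j h1 h2 => hr j h1 (by omega))
        rw [Finset.sum_Icc_succ_top (by omega), Finset.sum_Icc_succ_top (by omega),
          hr (i + 1) (by omega) le_rfl]
        linarith
    have hpt : ∀ j ∈ Finset.Icc 1 i, s (r j) * (r' j - r j) ≤ h (r' j) - h (r j) := by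
      intro j hj
      by_cases he : r' j = r j
      · rw [he]; simp
      · have := hs (r j) (r' j) (hr0 j hj) (hr'0 j hj) he
        linarith
    have hB := Finset.sum_le_sum hpt
    have hsub : ∑ j ∈ Finset.Icc 1 i, (h (r' j) - h (r j)) ≤ 0 := by
      rw [Finset.sum_sub_distrib]; linarith
    have hneg : ∑ j ∈ Finset.Icc 1 i, (r' j - r j) ≤ 0 := by
      by_contra hcon
      push Not at hcon
      nlinarith [mul_pos hsc hcon]
    refine ⟨hneg, fun h0 => ?_⟩
    by_contra hcon
    push Not at hcon
    obtain ⟨j, hj, hne⟩ := hcon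
    have hlt := Finset.sum_lt_sum hpt ⟨j, hj, by
      have := hs (r j) (r' j) (hr0 j hj) (hr'0 j hj) hne
      linarith⟩
    rw [h0] at hAb
    linarith

lemma wf_le {r : ℕ → ℝ} {m : ℕ} (h : WF N E Ebar φ ψ r m) : m ≤ N := by
  cases h with
  | zero => exact Nat.zero_le _
  | step => assumption

lemma wf_main (P : Prob N E Ebar φ ψ) {r r' : ℕ → ℝ} (hf : SUFeasible N E Ebar φ r)
    (hf' : SUFeasible N E Ebar φ r') {m : ℕ} (h : WF N E Ebar φ ψ r m) :
    (∑ j ∈ Finset.Icc 1 m, (r' j - r j) ≤ 0 ∧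
      (∑ j ∈ Finset.Icc 1 m, (r' j - r j) = 0 → ∀ j ∈ Finset.Icc 1 m, r' j = r j)) ∧
    (∀ j ∈ Finset.Icc 1 m, ∀ k, m < k → k ≤ N → r j ≤ vval E Ebar φ ψ r m k) ∧
    (∀ c : ℝ, 0 ≤ c → (∀ j ∈ Finset.Icc 1 m, r j ≤ c) → ∀ s : ℝ → ℝ, MonotoneOn s (Set.Ici 0) →
      s c * ∑ j ∈ Finset.Icc 1 m, (r' j - r j) ≤
        ∑ j ∈ Finset.Icc 1 m, s (r j) * (r' j - r j)) := by
  induction h with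
  | zero => simp
  | step m i hm hmi hiN hmin hr ih =>
    obtain ⟨-, ih2, ih3⟩ := ih
    have hfm := hf.restrict (wf_le hm)
    have hfi := hf.restrict hiN
    have hfi' := hf'.restrict hiN
    have hi1 : i ∈ Finset.Icc 1 i := Finset.mem_Icc.2 ⟨by omega, le_rfl⟩
    set c := vval E Ebar φ ψ r m i with hcdef
    have hc : 0 ≤ c := vval_nonneg P hmi hiN hfm
    have hcm : ∀ j ∈ Finset.Icc 1 m, r j ≤ c := fun j hj => ih2 j hj i hmi hiN
    have hci : ∀ j ∈ Finset.Icc 1 i, r j ≤ c := by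
      intro j hj
      rw [Finset.mem_Icc] at hj
      by_cases hjm : j ≤ m
      · exact hcm j (Finset.mem_Icc.2 ⟨hj.1, hjm⟩)
      · exact (hr j (by omega) hj.2).le
    have hcmp : ∑ j ∈ Finset.Icc 1 i, (r' j - r j) ≤ 0 ∧
        (∑ j ∈ Finset.Icc 1 i, (r' j - r j) = 0 → ∀ j ∈ Finset.Icc 1 i, r' j = r j) := by
      rcases vval_tight P hmi hiN hfm with ht | ht
      · refine compare goodCost_ffun r r' m i c hc hmi.le hr hfi.1 hfi'.1 hcm
          (ih3 c hc hcm) ?_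
        rw [sum_block ffun r c m i hmi.le hr, ht]
        exact hfi'.2.1 i hi1
      · refine compare P.hphi r r' m i c hc hmi.le hr hfi.1 hfi'.1 hcm
          (ih3 c hc hcm) ?_
        rw [sum_block φ r c m i hmi.le hr, ht]
        exact hfi'.2.2 i hi1
    refine ⟨hcmp, ?_, ?_⟩
    · intro j hj k hik hkN
      refine (hci j hj).trans ?_
      rw [le_vval_iff P hik hkN hfi hc, sum_block ffun r c m i hmi.le hr,
        sum_block φ r c m i hmi.le hr]
      have h1 := (le_vval_iff P (hmi.trans hik) hkN hfm hc).1 (hmin k (hmi.trans hik) hkN)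
      constructor
      · linarith [h1.1]
      · linarith [h1.2]
    · intro d hd hdr s hs
      have hcd : c ≤ d := by
        have := hdr i hi1
        rwa [hr i hmi le_rfl] at this
      have hAb : s c * ∑ j ∈ Finset.Icc 1 i, (r' j - r j) ≤
          ∑ j ∈ Finset.Icc 1 i, s (r j) * (r' j - r j) := by
        have h0 := ih3 c hc hcm s hs
        clear_value c
        clear hfi hfi' hi1 hci hcmp hmin hcdef hdr hiN
        have hmi' := hmi.le
        clear hmi
        induction i, hmi' using Nat.le_induction with
        | base => exact h0
        | succ i hi ih =>
          have := ih (fun j h1 h2 => hr j h1 (by omega))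
          rw [Finset.sum_Icc_succ_top (by omega), Finset.sum_Icc_succ_top (by omega),
            hr (i + 1) (by omega) le_rfl]
          linarith
      have := hs hc hd hcd
      nlinarith [hcmp.1]

lemma vval_congr {r w : ℕ → ℝ} {m i : ℕ} (h : ∀ j ∈ Finset.Icc 1 m, r j = w j) :
    vval E Ebar φ ψ r m i = vval E Ebar φ ψ w m i := by
  have h1 : ∑ j ∈ Finset.Icc 1 m, ffun (r j) = ∑ j ∈ Finset.Icc 1 m, ffun (w j) :=
    Finset.sum_congr rfl (fun j hj => by rw [h j hj])
  have h2 : ∑ j ∈ Finset.Icc 1 m, φ (r j) = ∑ j ∈ Finset.Icc 1 m, φ (w j) :=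
    Finset.sum_congr rfl (fun j hj => by rw [h j hj])
  rw [vval, vval, h1, h2]

lemma wf_congr {r w : ℕ → ℝ} {m : ℕ} (h : WF N E Ebar φ ψ r m)
    (he : ∀ j ∈ Finset.Icc 1 m, r j = w j) : WF N E Ebar φ ψ w m := by
  induction h with
  | zero => exact WF.zero
  | step m i hm hmi hiN hmin hr ih =>
    have hem : ∀ j ∈ Finset.Icc 1 m, r j = w j := fun j hj => by
      rw [Finset.mem_Icc] at hj
      exact he j (Finset.mem_Icc.2 (by omega))
    refine WF.step m i (ih hem) hmi hiN ?_ ?_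
    · intro k h1 h2
      rw [← vval_congr hem, ← vval_congr hem]
      exact hmin k h1 h2
    · intro j h1 h2
      rw [← vval_congr hem, ← he j (Finset.mem_Icc.2 (by omega))]
      exact hr j h1 h2

lemma wf_exists (P : Prob N E Ebar φ ψ) :
    ∃ w : ℕ → ℝ, SUFeasible N E Ebar φ w ∧ WF N E Ebar φ ψ w N := by
  suffices H : ∀ d m : ℕ, m + d = N → ∀ w, SUFeasible m E Ebar φ w → WF N E Ebar φ ψ w m →
      ∃ w : ℕ → ℝ, SUFeasible N E Ebar φ w ∧ WF N E Ebar φ ψ w N by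
    refine H N 0 (by omega) (fun _ => 0) ?_ WF.zero
    refine ⟨?_, ?_, ?_⟩ <;> simp
  intro d
  induction d using Nat.strong_induction_on with
  | _ d IH =>
    intro m hmd w hf hw
    rcases Nat.eq_zero_or_pos d with rfl | hd
    · simp only [Nat.add_zero] at hmd
      subst hmd
      exact ⟨w, hf, hw⟩
    obtain ⟨i, hi, hmin⟩ := Finset.exists_min_image (Finset.Icc (m + 1) N)
      (fun i => vval E Ebar φ ψ w m i) ⟨N, Finset.mem_Icc.2 (by omega)⟩
    rw [Finset.mem_Icc] at hi
    have hmi : m < i := by omega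
    have hmin' : ∀ k, m < k → k ≤ N → vval E Ebar φ ψ w m i ≤ vval E Ebar φ ψ w m k :=
      fun k h1 h2 => hmin k (Finset.mem_Icc.2 (by omega))
    set c := vval E Ebar φ ψ w m i with hcdef
    have hc : 0 ≤ c := vval_nonneg P hmi hi.2 hf
    set w' : ℕ → ℝ := fun j => if j ≤ m then w j else c with hw'
    have hold : ∀ j ∈ Finset.Icc 1 m, w j = w' j := by
      intro j hj
      rw [Finset.mem_Icc] at hj
      simp [hw', hj.2]
    have hnew : ∀ j, m < j → w' j = c := by
      intro j hj
      simp [hw', Nat.not_le.2 hj]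
    have hs : ∀ (h : ℝ → ℝ) (k : ℕ), k ≤ m →
        ∑ j ∈ Finset.Icc 1 k, h (w' j) = ∑ j ∈ Finset.Icc 1 k, h (w j) := by
      intro h k hk
      refine Finset.sum_congr rfl (fun j hj => ?_)
      rw [Finset.mem_Icc] at hj
      rw [hold j (Finset.mem_Icc.2 (by omega))]
    have hf' : SUFeasible i E Ebar φ w' := by
      refine ⟨?_, ?_, ?_⟩
      · intro j hj
        rw [Finset.mem_Icc] at hj
        by_cases hjm : j ≤ m
        · have hj' : j ∈ Finset.Icc 1 m := Finset.mem_Icc.2 ⟨hj.1, hjm⟩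
          rw [← hold j hj']
          exact hf.1 j hj'
        · rw [hnew j (by omega)]
          exact hc
      · intro k hk
        rw [Finset.mem_Icc] at hk
        by_cases hkm : k ≤ m
        · rw [hs ffun k hkm]
          exact hf.2.1 k (Finset.mem_Icc.2 ⟨hk.1, hkm⟩)
        · push Not at hkm
          rw [sum_block ffun w' c m k hkm.le (fun j h1 _ => hnew j h1), hs ffun m le_rfl]
          exact ((le_vval_iff P hkm (by omega) hf hc).1 (hmin' k hkm (by omega))).1
      · intro k hk
        rw [Finset.mem_Icc] at hk
        by_cases hkm : k ≤ m
        · rw [hs φ k hkm]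
          exact hf.2.2 k (Finset.mem_Icc.2 ⟨hk.1, hkm⟩)
        · push Not at hkm
          rw [sum_block φ w' c m k hkm.le (fun j h1 _ => hnew j h1), hs φ m le_rfl]
          exact ((le_vval_iff P hkm (by omega) hf hc).1 (hmin' k hkm (by omega))).2
    refine IH (N - i) (by omega) i (by omega) w' hf' ?_
    refine WF.step m i (wf_congr hw hold) hmi hi.2 ?_ ?_
    · intro k h1 h2
      rw [← vval_congr hold, ← vval_congr hold]
      exact hmin' k h1 h2
    · intro j h1 _
      rw [← vval_congr hold]
      exact hnew j h1

lemma wf_to_idx {r : ℕ → ℝ} {m : ℕ} (h : WF N E Ebar φ ψ r m) :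
    ∃ (M : ℕ) (idx : ℕ → ℕ),
        idx 0 = 0 ∧ idx M = m ∧ (∀ n < M, idx n < idx (n + 1)) ∧
        ∀ n : ℕ, 1 ≤ n → n ≤ M →
          (∀ i : ℕ, idx (n - 1) < i → i ≤ N →
              vval E Ebar φ ψ r (idx (n - 1)) (idx n) ≤ vval E Ebar φ ψ r (idx (n - 1)) i) ∧
          (∀ j : ℕ, idx (n - 1) < j → j ≤ idx n →
              r j = vval E Ebar φ ψ r (idx (n - 1)) (idx n)) := by
  induction h with
  | zero => exact ⟨0, fun _ => 0, rfl, rfl, by simp, fun n h1 h2 => by omega⟩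
  | step m i hm hmi hiN hmin hr ih =>
    obtain ⟨M, idx, h0, hM, hlt, hall⟩ := ih
    have hold : ∀ n, n ≤ M → (fun n => if n ≤ M then idx n else i) n = idx n := by
      intro n hn; simp [hn]
    have hnew : (fun n => if n ≤ M then idx n else i) (M + 1) = i := by simp
    refine ⟨M + 1, fun n => if n ≤ M then idx n else i, ?_, hnew, ?_, ?_⟩
    · rw [hold 0 (Nat.zero_le _)]; exact h0
    · intro n hn
      rw [hold n (by omega)]
      rcases Nat.lt_or_ge n M with h | h
      · rw [hold (n + 1) (by omega)]; exact hlt n h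
      · obtain rfl : n = M := by omega
        rw [hnew, hM]; exact hmi
    · intro n h1 h2
      rw [hold (n - 1) (by omega)]
      rcases Nat.lt_or_ge M n with h | h
      · obtain rfl : n = M + 1 := by omega
        rw [hnew, Nat.add_sub_cancel, hM]
        exact ⟨hmin, hr⟩
      · rw [hold n h]; exact hall n h1 h

lemma wf_of_idx {r : ℕ → ℝ} (M : ℕ) (idx : ℕ → ℕ) (h0 : idx 0 = 0) (hM : idx M = N)
    (hlt : ∀ n < M, idx n < idx (n + 1))
    (hall : ∀ n : ℕ, 1 ≤ n → n ≤ M →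
          (∀ i : ℕ, idx (n - 1) < i → i ≤ N →
              vval E Ebar φ ψ r (idx (n - 1)) (idx n) ≤ vval E Ebar φ ψ r (idx (n - 1)) i) ∧
          (∀ j : ℕ, idx (n - 1) < j → j ≤ idx n →
              r j = vval E Ebar φ ψ r (idx (n - 1)) (idx n))) :
    WF N E Ebar φ ψ r N := by
  have hle : ∀ d n, n + d = M → idx n ≤ N := by
    intro d
    induction d with
    | zero => intro n hn; rw [← hM, ← hn]; simp
    | succ d ih =>
      intro n hn
      exact (hlt n (by omega)).le.trans (ih (n + 1) (by omega))
  have key : ∀ n, n ≤ M → WF N E Ebar φ ψ r (idx n) := by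
    intro n
    induction n with
    | zero => intro _; rw [h0]; exact WF.zero
    | succ n ih =>
      intro hn
      have h := hall (n + 1) (by omega) hn
      rw [Nat.add_sub_cancel] at h
      exact WF.step (idx n) (idx (n + 1)) (ih (by omega)) (hlt n (by omega))
        (hle (M - (n + 1)) (n + 1) (by omega)) h.1 h.2
  have := key M le_rfl
  rwa [hM] at this

end

/-- a feasible rate policy is optimal iff it is the recursively defined
water-filling policy of Theorem 1. -/
theorem optimal_iff_waterfilling
    (N : ℕ) (hN : 1 ≤ N)
    (E Ebar : ℕ → ℝ)
    (hE : ∀ i ∈ Finset.Icc 1 N, 0 ≤ E i)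
    (hEbar : ∀ i ∈ Finset.Icc 1 N, 0 ≤ Ebar i)
    (φ ψ : ℝ → ℝ)
    (hphi_cont : ContinuousOn φ (Set.Ici 0))
    (hphi_mono : StrictMonoOn φ (Set.Ici 0))
    (hphi_conv : StrictConvexOn ℝ (Set.Ici 0) φ)
    (hphi0 : φ 0 = 0)
    (hphi_nonneg : ∀ x : ℝ, 0 ≤ x → 0 ≤ φ x)
    (hphi_surj : ∀ y : ℝ, 0 ≤ y → ∃ x : ℝ, 0 ≤ x ∧ φ x = y)
    (hpsi_left : ∀ x : ℝ, 0 ≤ x → ψ (φ x) = x)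
    (hpsi_right : ∀ y : ℝ, 0 ≤ y → φ (ψ y) = y)
    (hpsi_nonneg : ∀ y : ℝ, 0 ≤ y → 0 ≤ ψ y)
    (r : ℕ → ℝ)
    (hfeas : SUFeasible N E Ebar φ r) :
    (∀ r' : ℕ → ℝ, SUFeasible N E Ebar φ r' →
        ∑ i ∈ Finset.Icc 1 N, r' i ≤ ∑ i ∈ Finset.Icc 1 N, r i) ↔
    (∃ (M : ℕ) (idx : ℕ → ℕ),
        idx 0 = 0 ∧ idx M = N ∧ (∀ n < M, idx n < idx (n + 1)) ∧
        ∀ n : ℕ, 1 ≤ n → n ≤ M →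
          (∀ i : ℕ, idx (n - 1) < i → i ≤ N →
              vval E Ebar φ ψ r (idx (n - 1)) (idx n) ≤ vval E Ebar φ ψ r (idx (n - 1)) i) ∧
          (∀ j : ℕ, idx (n - 1) < j → j ≤ idx n →
              r j = vval E Ebar φ ψ r (idx (n - 1)) (idx n))) := by
  have P : Prob N E Ebar φ ψ :=
    ⟨hE, hEbar, goodCost_phi φ ψ hphi_mono hphi_conv hphi0 hpsi_right hpsi_nonneg⟩
  constructor
  · intro hopt
    obtain ⟨w, hw, hwf⟩ := wf_exists P
    have hmain := (wf_main P hw hfeas hwf).1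
    have h1 := hopt w hw
    have heq := hmain.2 (le_antisymm hmain.1 (by rw [Finset.sum_sub_distrib]; linarith))
    exact wf_to_idx (wf_congr hwf (fun j hj => (heq j hj).symm))
  · rintro ⟨M, idx, h0, hM, hlt, hall⟩ r' hr'
    have hwf := wf_of_idx M idx h0 hM hlt hall
    have hmain := (wf_main P hfeas hr' hwf).1.1
    rw [Finset.sum_sub_distrib] at hmain
    linarith
end

section
/- Given the optimal source rates r* (an optimal solution of the single-user problem with transmitter energies E and receiver energies δ), the relay rate policy r̃ defined by the following recursion is optimal for the inner problem: there exist indices 0 = i_0 < i_1 < ⋯ < i_M = N such that, for every n, defining for i_{n−1} < i ≤ N the value v_n(i) := min{ g( (∑_{j=1}^{i} (Ẽ_j − δ_j) − ∑_{j=1}^{i_{n−1}} f(r̃_j)) / (i − i_{n−1}) ), ψ( (∑_{j=1}^{i} Ē_j − ∑_{j=1}^{i_{n−1}} φ(r̃_j)) / (i − i_{n−1}) ), (∑_{j=1}^{i} r*_j − ∑_{j=1}^{i_{n−1}} r̃_j) / (i − i_{n−1}) }, the index i_n minimizes v_n(i) over i ∈ {i_{n−1}+1,…,N} and r̃_j =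 v_n(i_n) for all i_{n−1} < j ≤ i_n; then (r*, r̃) attains the maximum of the inner problem. -/
open Finset

/-- Feasibility of a pair (source rates `r`, relay rates `rt`) for the two-hop inner
problem with source energies `E`, relay energies `Et`, destination energies `Ebar`,
and relay decoding power strategy `δ`. -/
def InnerFeasible (N : ℕ) (E Et Ebar δ : ℕ → ℝ) (φ : ℝ → ℝ) (r rt : ℕ → ℝ) : Prop :=
  (∀ i ∈ Finset.Icc 1 N, 0 ≤ r i) ∧
  (∀ i ∈ Finset.Icc 1 N, 0 ≤ rt i) ∧
  (∀ k ∈ Finset.Icc 1 N,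
      ∑ i ∈ Finset.Icc 1 k, ffun (r i) ≤ ∑ i ∈ Finset.Icc 1 k, E i) ∧
  (∀ k ∈ Finset.Icc 1 N,
      ∑ i ∈ Finset.Icc 1 k, φ (r i) ≤ ∑ i ∈ Finset.Icc 1 k, δ i) ∧
  (∀ k ∈ Finset.Icc 1 N,
      ∑ i ∈ Finset.Icc 1 k, ffun (rt i) ≤ ∑ i ∈ Finset.Icc 1 k, (Et i - δ i)) ∧
  (∀ k ∈ Finset.Icc 1 N,
      ∑ i ∈ Finset.Icc 1 k, rt i ≤ ∑ i ∈ Finset.Icc 1 k, r i) ∧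
  (∀ k ∈ Finset.Icc 1 N,
      ∑ i ∈ Finset.Icc 1 k, φ (rt i) ≤ ∑ i ∈ Finset.Icc 1 k, Ebar i)

/-- The three-term water-filling candidate value `v_n(i)` for relay rates starting after
slot `m = i_{n-1}`: the minimum of the relay transmission-energy level, the destination
decoding-energy level, and the available-data level. -/
noncomputable def vval3 (Et δ Ebar : ℕ → ℝ) (φ ψ : ℝ → ℝ) (rstar rt : ℕ → ℝ)
    (m i : ℕ) : ℝ :=
  min (min
    (gfun ((∑ j ∈ Finset.Icc 1 i, (Et j - δ j) - ∑ j ∈ Finset.Icc 1 m, ffun (rt j)) /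
      ((i : ℝ) - (m : ℝ))))
    (ψ ((∑ j ∈ Finset.Icc 1 i, Ebar j - ∑ j ∈ Finset.Icc 1 m, φ (rt j)) /
      ((i : ℝ) - (m : ℝ)))))
    ((∑ j ∈ Finset.Icc 1 i, rstar j - ∑ j ∈ Finset.Icc 1 m, rt j) /
      ((i : ℝ) - (m : ℝ)))

/-- The properties of a cost function used in the proof. -/
structure GoodCost_s7 (c : ℝ → ℝ) : Prop where
  cont : ContinuousOn c (Set.Ici 0)
  mono : StrictMonoOn c (Set.Ici 0)
  conv : StrictConvexOn ℝ (Set.Ici 0) c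
  zero : c 0 = 0

theorem goodCost_ffun_s7 : GoodCost_s7 ffun := by
  have hexp : ∀ x, ffun x = Real.exp (Real.log 2 * 2 * x) - 1 := by
    intro x
    unfold ffun
    rw [Real.rpow_def_of_pos (by norm_num)]
    ring_nf
  have hl : 0 < Real.log 2 := Real.log_pos (by norm_num)
  have hfe : ffun = fun x => Real.exp (Real.log 2 * 2 * x) - 1 := funext hexp
  refine ⟨?_, ?_, ?_, ?_⟩
  · rw [hfe]; fun_prop
  · intro x _ y _ hxy
    rw [hexp, hexp]
    have : Real.log 2 * 2 * x < Real.log 2 * 2 * y := by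
      apply mul_lt_mul_of_pos_left hxy; positivity
    have := Real.exp_lt_exp.2 this
    linarith
  · refine ⟨convex_Ici 0, ?_⟩
    intro x _ y _ hxy a b ha hb hab
    rw [hexp, hexp, hexp]
    have hne : Real.log 2 * 2 * x ≠ Real.log 2 * 2 * y := by
      intro h
      apply hxy
      have : Real.log 2 * 2 ≠ 0 := by positivity
      exact mul_left_cancel₀ this h
    have := strictConvexOn_exp.2 (Set.mem_univ _) (Set.mem_univ _) hne ha hb hab
    simp only [smul_eq_mul] at this ⊢
    have e : Real.log 2 * 2 * (a * x + b * y)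
        = a * (Real.log 2 * 2 * x) + b * (Real.log 2 * 2 * y) := by ring
    rw [e]
    nlinarith
  · simp [ffun]

theorem GoodCost_s7.nonneg {c : ℝ → ℝ} (hc : GoodCost_s7 c) {x : ℝ} (hx : 0 ≤ x) : 0 ≤ c x := by
  have := hc.mono.monotoneOn (Set.mem_Ici.2 le_rfl) (Set.mem_Ici.2 hx) hx
  rwa [hc.zero] at this

theorem GoodCost_s7.subgrad {c : ℝ → ℝ} (hc : GoodCost_s7 c) {x : ℝ} (hx : 0 < x) :
    ∃ w : ℝ, ∀ y, 0 ≤ y → c x + w * (y - x) ≤ c y := by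
  let S : Set ℝ := (fun z => (c x - c z) / (x - z)) '' Set.Ico 0 x
  have hub : ∀ y, x < y → ∀ s ∈ S, s ≤ (c y - c x) / (y - x) := by
    rintro y hy _ ⟨z, hz, rfl⟩
    exact hc.conv.convexOn.slope_mono_adjacent (Set.mem_Ici.2 hz.1)
      (Set.mem_Ici.2 (by linarith)) hz.2 hy
  have hne : S.Nonempty := ⟨_, 0, ⟨le_rfl, hx⟩, rfl⟩
  have hbdd : BddAbove S := ⟨_, fun s hs => hub (x + 1) (by linarith) s hs⟩
  refine ⟨sSup S, fun y hy => ?_⟩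
  rcases lt_trichotomy y x with h | h | h
  · have h1 : (c x - c y) / (x - y) ≤ sSup S := le_csSup hbdd ⟨y, ⟨hy, h⟩, rfl⟩
    rw [div_le_iff₀ (by linarith)] at h1
    nlinarith
  · subst h; simp
  · have h1 : sSup S ≤ (c y - c x) / (y - x) := csSup_le hne (hub y h)
    rw [le_div_iff₀ (by linarith)] at h1
    linarith

theorem GoodCost_s7.exists_weight {c : ℝ → ℝ} (hc : GoodCost_s7 c) :
    ∃ w : ℝ → ℝ, (∀ x, 0 < x → 0 < w x) ∧ (∀ x y, 0 ≤ x → x ≤ y → w x ≤ w y) ∧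
      ∀ x y, 0 ≤ x → 0 ≤ y → c x + w x * (y - x) ≤ c y := by
  have h : ∀ x : ℝ, ∃ w : ℝ, (x = 0 → w = 0) ∧
      (0 ≤ x → ∀ y, 0 ≤ y → c x + w * (y - x) ≤ c y) := by
    intro x
    by_cases hx : 0 < x
    · obtain ⟨w, hw⟩ := hc.subgrad hx
      exact ⟨w, fun h => absurd h hx.ne', fun _ => hw⟩
    · refine ⟨0, fun _ => rfl, fun h y hy => ?_⟩
      have : x = 0 := le_antisymm (not_lt.1 hx) h
      subst this
      simpa [hc.zero] using hc.nonneg hy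
  choose w hw0 hw using h
  refine ⟨w, ?_, ?_, fun x y hx hy => hw x hx y hy⟩
  · intro x hx
    have h1 := hw x hx.le 0 le_rfl
    have h2 := hc.mono (Set.mem_Ici.2 le_rfl) (Set.mem_Ici.2 hx.le) hx
    by_contra hcon
    nlinarith
  · intro x y hx hxy
    rcases hxy.eq_or_lt with h | h
    · rw [h]
    · have h1 := hw x hx y (hx.trans hxy)
      have h2 := hw y (hx.trans hxy) x hx
      by_contra hcon
      nlinarith

/-- One comparison step. -/
theorem compare_step {c : ℝ → ℝ} (hc : GoodCost_s7 c) (s s' : ℕ → ℝ) (k : ℕ)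
    (hmono : ∀ i, 1 ≤ i → i < k → s i ≤ s (i + 1))
    (h0 : ∀ i, 1 ≤ i → i ≤ k → 0 ≤ s i) (h0' : ∀ i, 1 ≤ i → i ≤ k → 0 ≤ s' i)
    (hprev : ∀ i, 1 ≤ i → i < k → s i < s (i + 1) →
      ∑ j ∈ Icc 1 i, s' j ≤ ∑ j ∈ Icc 1 i, s j)
    (hcost : ∑ j ∈ Icc 1 k, c (s' j) ≤ ∑ j ∈ Icc 1 k, c (s j)) :
    ∑ j ∈ Icc 1 k, s' j ≤ ∑ j ∈ Icc 1 k, s j := by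
  obtain ⟨w, wpos, wmono, wsub⟩ := hc.exists_weight
  rcases Nat.eq_zero_or_pos k with hk | hk
  · subst hk; simp
  have key : ∀ m, m + 1 ≤ k →
      w (s (m + 1)) * (∑ j ∈ Icc 1 (m + 1), s' j - ∑ j ∈ Icc 1 (m + 1), s j) ≤
      ∑ j ∈ Icc 1 (m + 1), c (s' j) - ∑ j ∈ Icc 1 (m + 1), c (s j) := by
    intro m
    induction m with
    | zero =>
      intro h
      have := wsub (s 1) (s' 1) (h0 1 le_rfl h) (h0' 1 le_rfl h)
      simp only [zero_add, Icc_self, sum_singleton]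
      linarith
    | succ m ih =>
      intro h
      have ih := ih (by omega)
      have h1 := wsub (s (m + 1 + 1)) (s' (m + 1 + 1)) (h0 _ (by omega) h) (h0' _ (by omega) h)
      have hm := hmono (m + 1) (by omega) (by omega)
      have hww : (w (s (m + 1 + 1)) - w (s (m + 1))) *
          (∑ j ∈ Icc 1 (m + 1), s' j - ∑ j ∈ Icc 1 (m + 1), s j) ≤ 0 := by
        rcases hm.eq_or_lt with he | hl
        · rw [he]; simp
        · have a := hprev (m + 1) (by omega) (by omega) hl
          have b := wmono _ _ (h0 (m + 1) (by omega) (by omega)) hm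
          exact mul_nonpos_of_nonneg_of_nonpos (by linarith) (by linarith)
      rw [sum_Icc_succ_top (by omega : 1 ≤ m + 1 + 1) s',
        sum_Icc_succ_top (by omega : 1 ≤ m + 1 + 1) s,
        sum_Icc_succ_top (by omega : 1 ≤ m + 1 + 1) (fun j => c (s' j)),
        sum_Icc_succ_top (by omega : 1 ≤ m + 1 + 1) (fun j => c (s j))]
      linarith
  obtain ⟨m, rfl⟩ : ∃ m, k = m + 1 := ⟨k - 1, by omega⟩
  have hk2 := key m le_rfl
  rcases (h0 (m + 1) hk le_rfl).eq_or_lt with hz | hp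
  · -- all `s` vanish up to `m + 1`
    have hall : ∀ d, d ≤ m → s (m + 1 - d) = 0 := by
      intro d
      induction d with
      | zero => intro _; simpa using hz.symm
      | succ d ih =>
        intro hd
        have e := ih (by omega)
        have a := hmono (m + 1 - (d + 1)) (by omega) (by omega)
        have : m + 1 - (d + 1) + 1 = m + 1 - d := by omega
        rw [this, e] at a
        exact le_antisymm a (h0 _ (by omega) (by omega))
    have hall' : ∀ j ∈ Icc 1 (m + 1), s j = 0 := by
      intro j hj
      rw [mem_Icc] at hj
      have := hall (m + 1 - j) (by omega)
      rwa [show m + 1 - (m + 1 - j) = j by omega] at this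
    have hcs : ∑ j ∈ Icc 1 (m + 1), c (s j) = 0 :=
      sum_eq_zero fun j hj => by rw [hall' j hj, hc.zero]
    rw [hcs] at hcost
    have hnn : ∀ j ∈ Icc 1 (m + 1), 0 ≤ c (s' j) := fun j hj => by
      rw [mem_Icc] at hj; exact hc.nonneg (h0' j hj.1 hj.2)
    have hz2 := (sum_eq_zero_iff_of_nonneg hnn).1 (le_antisymm hcost (sum_nonneg hnn))
    apply sum_le_sum
    intro j hj
    rw [hall' j hj]
    by_contra hcon
    have a := hz2 j hj
    have b := hc.mono (Set.mem_Ici.2 le_rfl) (Set.mem_Ici.2 (not_le.1 hcon).le) (not_le.1 hcon)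
    rw [hc.zero] at b
    linarith
  · have := wpos _ hp
    by_contra hcon
    have : 0 < w (s (m + 1)) * (∑ j ∈ Icc 1 (m + 1), s' j - ∑ j ∈ Icc 1 (m + 1), s j) :=
      mul_pos this (by linarith)
    linarith

/-- The comparison lemma. -/
theorem compare_main (N : ℕ) (s s' : ℕ → ℝ)
    (hmono : ∀ i, 1 ≤ i → i < N → s i ≤ s (i + 1))
    (h0 : ∀ i, 1 ≤ i → i ≤ N → 0 ≤ s i) (h0' : ∀ i, 1 ≤ i → i ≤ N → 0 ≤ s' i)
    (H : ∀ i, 1 ≤ i → i ≤ N → (i = N ∨ s i < s (i + 1)) →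
      (∑ j ∈ Icc 1 i, s' j ≤ ∑ j ∈ Icc 1 i, s j) ∨
      ∃ c, GoodCost_s7 c ∧ ∑ j ∈ Icc 1 i, c (s' j) ≤ ∑ j ∈ Icc 1 i, c (s j)) :
    ∀ i, 1 ≤ i → i ≤ N → (i = N ∨ s i < s (i + 1)) →
      ∑ j ∈ Icc 1 i, s' j ≤ ∑ j ∈ Icc 1 i, s j := by
  intro i
  induction i using Nat.strong_induction_on with
  | _ i ih =>
    intro h1 h2 h3
    rcases H i h1 h2 h3 with h | ⟨c, hc, h⟩
    · exact h
    · refine compare_step hc s s' i (fun j a b => hmono j a (by omega))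
        (fun j a b => h0 j a (by omega)) (fun j a b => h0' j a (by omega)) ?_ h
      intro j a b hlt
      exact ih j b a (by omega) (Or.inr hlt)

theorem sum_update_two (F : ℝ → ℝ) (r : ℕ → ℝ) (i : ℕ) (hi : 1 ≤ i) (x y : ℝ) (k : ℕ) :
    ∑ j ∈ Icc 1 k, F (if j = i then x else if j = i + 1 then y else r j) =
      ∑ j ∈ Icc 1 k, F (r j) + (if i ≤ k then F x - F (r i) else 0) +
        (if i + 1 ≤ k then F y - F (r (i + 1)) else 0) := by
  induction k with
  | zero =>
    rw [if_neg (by omega), if_neg (by omega)]; simp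
  | succ k ih =>
    rw [sum_Icc_succ_top (by omega), sum_Icc_succ_top (by omega), ih]
    rcases lt_trichotomy (k + 1) i with h | h | h
    · rw [if_neg (by omega), if_neg (by omega), if_neg (by omega), if_neg (by omega),
        if_neg (by omega), if_neg (by omega)]
      ring
    · subst h
      simp
    · by_cases h' : k = i
      · subst h'
        simp
        ring
      · rw [if_pos (by omega), if_pos (by omega), if_neg (by omega), if_neg (by omega),
          if_pos (by omega), if_pos (by omega)]
        ring

theorem su_no_improve (N : ℕ) (E δ : ℕ → ℝ) (φ : ℝ → ℝ) (hφ : GoodCost_s7 φ) (r : ℕ → ℝ)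
    (hf : SUFeasible N E δ φ r)
    (hopt : ∀ r' : ℕ → ℝ, SUFeasible N E δ φ r' →
        ∑ i ∈ Finset.Icc 1 N, r' i ≤ ∑ i ∈ Finset.Icc 1 N, r i)
    (i : ℕ) (hi : 1 ≤ i) (hiN : i < N) (x y : ℝ) (hx : 0 ≤ x) (hy : 0 ≤ y)
    (hxy : x + y = r i + r (i + 1))
    (h1 : ffun x + ffun y < ffun (r i) + ffun (r (i + 1)))
    (h2 : φ x + φ y < φ (r i) + φ (r (i + 1)))
    (h3 : ∑ j ∈ Icc 1 i, ffun (r j) + (ffun x - ffun (r i)) ≤ ∑ j ∈ Icc 1 i, E j)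
    (h4 : ∑ j ∈ Icc 1 i, φ (r j) + (φ x - φ (r i)) ≤ ∑ j ∈ Icc 1 i, δ j) : False := by
  have ev : ∀ c : ℝ → ℝ, GoodCost_s7 c → c x + c y < c (r i) + c (r (i + 1)) →
      ∀ᶠ z in nhdsWithin y (Set.Ioi y), c x + c z < c (r i) + c (r (i + 1)) := by
    intro c hc h
    have hcw : Filter.Tendsto c (nhdsWithin y (Set.Ioi y)) (nhds (c y)) :=
      (hc.cont y (Set.mem_Ici.2 hy)).mono_left
        (nhdsWithin_mono _ fun z hz => Set.mem_Ici.2 (hy.trans (le_of_lt hz)))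
    have : c y < c (r i) + c (r (i + 1)) - c x := by linarith
    filter_upwards [hcw.eventually_lt_const this] with z hz
    linarith
  obtain ⟨z, ⟨hz1, hz2⟩, hz⟩ := (((ev ffun goodCost_ffun_s7 h1).and (ev φ hφ h2)).and
    (self_mem_nhdsWithin)).exists
  have hz : y < z := hz
  obtain ⟨f0, f1, f2⟩ := hf
  have hcon := hopt (fun j => if j = i then x else if j = i + 1 then z else r j) ?_
  · have := sum_update_two (fun t => t) r i hi x z N
    rw [this, if_pos (by omega), if_pos (by omega)] at hcon
    linarith
  · refine ⟨?_, ?_, ?_⟩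
    · intro j hj
      have := f0 j hj
      dsimp only
      split_ifs <;> linarith
    · intro k hk
      have := f1 k hk
      rw [sum_update_two ffun r i hi x z k]
      rcases lt_trichotomy k i with h | h | h
      · rw [if_neg (by omega), if_neg (by omega)]; linarith
      · subst h; rw [if_pos (by omega), if_neg (by omega)]; linarith
      · rw [if_pos (by omega), if_pos (by omega)]; linarith
    · intro k hk
      have := f2 k hk
      rw [sum_update_two φ r i hi x z k]
      rcases lt_trichotomy k i with h | h | h
      · rw [if_neg (by omega), if_neg (by omega)]; linarith
      · subst h; rw [if_pos (by omega), if_neg (by omega)]; linarith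
      · rw [if_pos (by omega), if_pos (by omega)]; linarith

/-- Moving two points towards each other strictly decreases the total cost. -/
theorem GoodCost_s7.smooth {c : ℝ → ℝ} (hc : GoodCost_s7 c) {a b t : ℝ} (ha : 0 ≤ a) (hab : a < b)
    (ht0 : 0 < t) (ht1 : t < b - a) : c (a + t) + c (b - t) < c a + c b := by
  have hd : 0 < b - a := by linarith
  set l := t / (b - a) with hl
  have hl0 : 0 < l := by positivity
  have hl1 : l < 1 := by rw [hl, div_lt_one hd]; exact ht1
  have hlt : l * (b - a) = t := by rw [hl]; field_simp
  have hA : a ∈ Set.Ici (0 : ℝ) := ha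
  have hB : b ∈ Set.Ici (0 : ℝ) := Set.mem_Ici.2 (by linarith)
  have e1 := hc.conv.2 hA hB hab.ne (sub_pos.2 hl1) hl0 (by ring)
  have e2 := hc.conv.2 hA hB hab.ne hl0 (sub_pos.2 hl1) (by ring)
  simp only [smul_eq_mul] at e1 e2
  rw [show (1 - l) * a + l * b = a + t by rw [← hlt]; ring] at e1
  rw [show l * a + (1 - l) * b = b - t by rw [← hlt]; ring] at e2
  linarith

theorem su_mono (N : ℕ) (E δ : ℕ → ℝ) (φ : ℝ → ℝ) (hφ : GoodCost_s7 φ) (r : ℕ → ℝ)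
    (hf : SUFeasible N E δ φ r)
    (hopt : ∀ r' : ℕ → ℝ, SUFeasible N E δ φ r' →
        ∑ i ∈ Finset.Icc 1 N, r' i ≤ ∑ i ∈ Finset.Icc 1 N, r i)
    (i : ℕ) (hi : 1 ≤ i) (hiN : i < N) : r i ≤ r (i + 1) := by
  by_contra hcon
  have hlt := not_le.1 hcon
  have hb := hf.1 (i + 1) (mem_Icc.2 (by omega))
  have hlt' : r (i + 1) < r i := hlt
  set a := r (i + 1) with ha
  set b := r i with hbdef
  have sm : ∀ c : ℝ → ℝ, GoodCost_s7 c →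
      c ((a + b) / 2) + c ((a + b) / 2) < c b + c a ∧ c ((a + b) / 2) ≤ c b := by
    intro c hc
    have h1 := hc.smooth (t := (b - a) / 2) hb hlt' (by linarith) (by linarith)
    rw [show a + (b - a) / 2 = (a + b) / 2 by ring,
      show b - (b - a) / 2 = (a + b) / 2 by ring] at h1
    refine ⟨by linarith, hc.mono.monotoneOn (Set.mem_Ici.2 (by linarith))
      (Set.mem_Ici.2 (by linarith)) (by linarith)⟩
  refine su_no_improve N E δ φ hφ r hf hopt i hi hiN ((a + b) / 2) ((a + b) / 2)
    (by linarith) (by linarith) ?_ (sm _ goodCost_ffun_s7).1 (sm _ hφ).1 ?_ ?_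
  · rw [← ha, ← hbdef]; ring
  · have := hf.2.1 i (mem_Icc.2 (by omega))
    have := (sm _ goodCost_ffun_s7).2
    linarith
  · have := hf.2.2 i (mem_Icc.2 (by omega))
    have := (sm _ hφ).2
    linarith

theorem su_tight (N : ℕ) (E δ : ℕ → ℝ) (φ : ℝ → ℝ) (hφ : GoodCost_s7 φ) (r : ℕ → ℝ)
    (hf : SUFeasible N E δ φ r)
    (hopt : ∀ r' : ℕ → ℝ, SUFeasible N E δ φ r' →
        ∑ i ∈ Finset.Icc 1 N, r' i ≤ ∑ i ∈ Finset.Icc 1 N, r i)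
    (i : ℕ) (hi : 1 ≤ i) (hiN : i < N) (hlt : r i < r (i + 1)) :
    ∑ j ∈ Icc 1 i, E j ≤ ∑ j ∈ Icc 1 i, ffun (r j) ∨
    ∑ j ∈ Icc 1 i, δ j ≤ ∑ j ∈ Icc 1 i, φ (r j) := by
  by_contra hcon
  push Not at hcon
  obtain ⟨c1, c2⟩ := hcon
  have h0 := hf.1 i (mem_Icc.2 (by omega))
  have ev : ∀ (c : ℝ → ℝ) (u v : ℝ), GoodCost_s7 c → u < v →
      ∀ᶠ z in nhdsWithin (r i) (Set.Ioi (r i)), u + (c z - c (r i)) < v := by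
    intro c u v hc h
    have hcw : Filter.Tendsto c (nhdsWithin (r i) (Set.Ioi (r i))) (nhds (c (r i))) :=
      (hc.cont (r i) (Set.mem_Ici.2 h0)).mono_left
        (nhdsWithin_mono _ fun z hz => Set.mem_Ici.2 (h0.trans (le_of_lt hz)))
    have : c (r i) < v - u + c (r i) := by linarith
    filter_upwards [hcw.eventually_lt_const this] with z hz
    linarith
  obtain ⟨z, ⟨hz1, hz2⟩, hz⟩ := (((ev ffun _ _ goodCost_ffun_s7 c1).and (ev φ _ _ hφ c2)).and
    (Ioo_mem_nhdsGT hlt)).exists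
  have hza := hz.1
  have hzb := hz.2
  have sm : ∀ c : ℝ → ℝ, GoodCost_s7 c →
      c z + c (r i + r (i + 1) - z) < c (r i) + c (r (i + 1)) := by
    intro c hc
    have h1 := hc.smooth (t := z - r i) h0 hlt (by linarith) (by linarith)
    rwa [show r i + (z - r i) = z by ring,
      show r (i + 1) - (z - r i) = r i + r (i + 1) - z by ring] at h1
  exact su_no_improve N E δ φ hφ r hf hopt i hi hiN z (r i + r (i + 1) - z)
    (by linarith) (by linarith) (by ring) (sm _ goodCost_ffun_s7) (sm _ hφ) hz1.le hz2.le

/-- An optimal single-user policy dominates every feasible one at its increase points. -/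
theorem su_dominates (N : ℕ) (E δ : ℕ → ℝ) (φ : ℝ → ℝ) (hφ : GoodCost_s7 φ) (r : ℕ → ℝ)
    (hf : SUFeasible N E δ φ r)
    (hopt : ∀ r' : ℕ → ℝ, SUFeasible N E δ φ r' →
        ∑ i ∈ Finset.Icc 1 N, r' i ≤ ∑ i ∈ Finset.Icc 1 N, r i)
    (r' : ℕ → ℝ) (hf' : SUFeasible N E δ φ r') :
    ∀ i, 1 ≤ i → i ≤ N → (i = N ∨ r i < r (i + 1)) →
      ∑ j ∈ Icc 1 i, r' j ≤ ∑ j ∈ Icc 1 i, r j := by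
  apply compare_main N r r' (su_mono N E δ φ hφ r hf hopt)
    (fun i a b => hf.1 i (mem_Icc.2 ⟨a, b⟩)) (fun i a b => hf'.1 i (mem_Icc.2 ⟨a, b⟩))
  intro i h1 h2 h3
  by_cases hN : i = N
  · left; rw [hN]; exact hopt r' hf'
  · right
    rcases su_tight N E δ φ hφ r hf hopt i h1 (by omega) (h3.resolve_left hN) with h | h
    · exact ⟨ffun, goodCost_ffun_s7, (hf'.2.1 i (mem_Icc.2 ⟨h1, h2⟩)).trans h⟩
    · exact ⟨φ, hφ, (hf'.2.2 i (mem_Icc.2 ⟨h1, h2⟩)).trans h⟩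

theorem sum_block_s7 (F : ℕ → ℝ) (m : ℕ) (v : ℝ) (d : ℕ)
    (h : ∀ j, m < j → j ≤ m + d → F j = v) :
    ∑ j ∈ Icc 1 (m + d), F j = ∑ j ∈ Icc 1 m, F j + (d : ℝ) * v := by
  induction d with
  | zero => simp
  | succ d ih =>
    rw [← add_assoc, sum_Icc_succ_top (by omega), ih (fun j a b => h j a (by omega)),
      h (m + d + 1) (by omega) (by omega)]
    push_cast
    ring

/-- Abstract water-filling structure. -/
theorem waterfill {ι : Type} (N : ℕ) (c : ι → ℝ → ℝ) (B : ι → ℕ → ℝ) (rt : ℕ → ℝ)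
    (hc0 : ∀ a, c a 0 = 0) (hcn : ∀ a x, 0 ≤ x → 0 ≤ c a x)
    (hB : ∀ a i, 1 ≤ i → i ≤ N → 0 ≤ B a i)
    (M : ℕ) (idx : ℕ → ℕ) (h0 : idx 0 = 0) (hM : idx M = N)
    (hidx : ∀ n < M, idx n < idx (n + 1))
    (V : ℕ → ℕ → ℝ)
    (hV : ∀ m i, m < i → i ≤ N → (∀ a, 0 ≤ B a i - ∑ j ∈ Icc 1 m, c a (rt j)) →
      (∀ v, 0 ≤ v → (v ≤ V m i ↔
        ∀ a, ((i : ℝ) - m) * c a v ≤ B a i - ∑ j ∈ Icc 1 m, c a (rt j))) ∧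
      ∃ a, ((i : ℝ) - m) * c a (V m i) = B a i - ∑ j ∈ Icc 1 m, c a (rt j))
    (hmin : ∀ n < M, ∀ i, idx n < i → i ≤ N → V (idx n) (idx (n + 1)) ≤ V (idx n) i)
    (hrt : ∀ n < M, ∀ j, idx n < j → j ≤ idx (n + 1) → rt j = V (idx n) (idx (n + 1))) :
    (∀ i, 1 ≤ i → i ≤ N → 0 ≤ rt i) ∧ (∀ i, 1 ≤ i → i < N → rt i ≤ rt (i + 1)) ∧
    (∀ a k, 1 ≤ k → k ≤ N → ∑ j ∈ Icc 1 k, c a (rt j) ≤ B a k) ∧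
    (∀ i, 1 ≤ i → i ≤ N → (i = N ∨ rt i < rt (i + 1)) →
      ∃ a, ∑ j ∈ Icc 1 i, c a (rt j) = B a i) := by
  have hidxN : ∀ d, d ≤ M → idx (M - d) ≤ N := by
    intro d
    induction d with
    | zero => intro _; simp [hM]
    | succ d ih =>
      intro h
      have a := ih (by omega)
      have b := hidx (M - (d + 1)) (by omega)
      rw [show M - (d + 1) + 1 = M - d by omega] at b
      omega
  have hidxN : ∀ n, n ≤ M → idx n ≤ N := by
    intro n hn
    have := hidxN (M - n) (by omega)
    rwa [show M - (M - n) = n by omega] at this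
  have inv : ∀ n, n ≤ M →
      (∀ i, 1 ≤ i → i ≤ idx n → 0 ≤ rt i) ∧ (∀ i, 1 ≤ i → i < idx n → rt i ≤ rt (i + 1)) ∧
      (∀ a k, 1 ≤ k → k ≤ idx n → ∑ j ∈ Icc 1 k, c a (rt j) ≤ B a k) ∧
      (∀ i, 1 ≤ i → i ≤ idx n → (i = idx n ∨ rt i < rt (i + 1)) →
        ∃ a, ∑ j ∈ Icc 1 i, c a (rt j) = B a i) ∧
      ∃ L, 0 ≤ L ∧ (1 ≤ idx n → rt (idx n) = L) ∧ ∀ a i, idx n < i → i ≤ N →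
        ((i : ℝ) - (idx n : ℕ)) * c a L ≤ B a i - ∑ j ∈ Icc 1 (idx n), c a (rt j) := by
    intro n
    induction n with
    | zero =>
      intro _
      rw [h0]
      refine ⟨fun i a b => by omega, fun i a b => by omega, fun _ k a b => by omega,
        fun i a b => by omega, 0, le_rfl, fun h => by omega, ?_⟩
      intro a i h1 h2
      simpa [hc0] using hB a i h1 h2
    | succ n ih =>
      intro hn
      obtain ⟨i1, i2, i3, i4, L, hL0, hL1, hL2⟩ := ih (by omega)
      have hlt := hidx n (by omega)
      have hle := hidxN (n + 1) hn
      have hmn := hmin n (by omega)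
      have hr := hrt n (by omega)
      clear ih
      generalize idx n = m at *
      generalize idx (n + 1) = m' at *
      have hrem : ∀ i, m < i → i ≤ N → ∀ a, 0 ≤ B a i - ∑ j ∈ Icc 1 m, c a (rt j) := by
        intro i a b q
        refine le_trans (mul_nonneg ?_ (hcn q L hL0)) (hL2 q i a b)
        have : (m : ℝ) < i := by exact_mod_cast a
        linarith
      set v := V m m' with hv
      have hLv : L ≤ v :=
        ((hV m m' hlt hle (hrem m' hlt hle)).1 L hL0).2 (fun a => hL2 a m' hlt hle)
      have hv0 : 0 ≤ v := hL0.trans hLv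
      have hfeas : ∀ i, m < i → i ≤ N → ∀ a,
          ((i : ℝ) - m) * c a v ≤ B a i - ∑ j ∈ Icc 1 m, c a (rt j) := fun i a b =>
        ((hV m i a b (hrem i a b)).1 v hv0).1 (hmn i a b)
      have hsum : ∀ a k, m ≤ k → k ≤ m' →
          ∑ j ∈ Icc 1 k, c a (rt j) = ∑ j ∈ Icc 1 m, c a (rt j) + ((k : ℝ) - m) * c a v := by
        intro a k h1 h2
        obtain ⟨d, rfl⟩ : ∃ d, k = m + d := ⟨k - m, by omega⟩
        rw [sum_block_s7 (fun j => c a (rt j)) m (c a v) d (fun j p q => by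
          rw [hr j p (by omega)])]
        push_cast; ring
      refine ⟨?_, ?_, ?_, ?_, v, hv0, fun _ => hr m' hlt le_rfl, ?_⟩
      · intro i a b
        by_cases h : i ≤ m
        · exact i1 i a h
        · rw [hr i (by omega) b]; exact hv0
      · intro i a b
        rcases lt_trichotomy i m with h | h | h
        · exact i2 i a h
        · subst h
          rw [hL1 a, hr _ (by omega) (by omega)]; exact hLv
        · rw [hr i h (by omega), hr (i + 1) (by omega) (by omega)]
      · intro a k h1 h2
        by_cases h : k ≤ m
        · exact i3 a k h1 h
        · rw [hsum a k (by omega) h2]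
          have := hfeas k (by omega) (by omega) a
          linarith
      · intro i a b h
        by_cases him : i ≤ m
        · apply i4 i a him
          rcases h with h | h
          · omega
          · exact Or.inr h
        · by_cases him' : i = m'
          · subst him'
            obtain ⟨q, hq⟩ := (hV m i hlt hle (hrem i hlt hle)).2
            refine ⟨q, ?_⟩
            rw [hsum q i (by omega) le_rfl]
            rw [← hv] at hq
            linarith
          · exfalso
            have h := h.resolve_left him'
            rw [hr i (by omega) b, hr (i + 1) (by omega) (by omega)] at h
            exact lt_irrefl _ h
      · intro a i h1 h2
        rw [hsum a m' (by omega) le_rfl]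
        have := hfeas i (by omega) h2 a
        linarith
  obtain ⟨a1, a2, a3, a4, -⟩ := inv M le_rfl
  rw [hM] at a1 a2 a3 a4
  exact ⟨a1, a2, a3, a4⟩

/-- Comparing a level with an inverse cost. -/
theorem level_iff {c h : ℝ → ℝ} (hmono : StrictMonoOn c (Set.Ici 0))
    (hh0 : ∀ y, 0 ≤ y → 0 ≤ h y) (hch : ∀ y, 0 ≤ y → c (h y) = y) {d y : ℝ} (hd : 0 < d)
    (hy : 0 ≤ y) :
    (∀ v, 0 ≤ v → (v ≤ h (y / d) ↔ d * c v ≤ y)) ∧ d * c (h (y / d)) = y := by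
  have hyd : 0 ≤ y / d := by positivity
  constructor
  · intro v hv
    rw [← hmono.le_iff_le (Set.mem_Ici.2 hv) (Set.mem_Ici.2 (hh0 _ hyd)), hch _ hyd,
      le_div_iff₀ hd, mul_comm]
  · rw [hch _ hyd]; field_simp

theorem gfun_nonneg (y : ℝ) (hy : 0 ≤ y) : 0 ≤ gfun y := by
  unfold gfun
  have := Real.logb_nonneg (b := 2) (by norm_num) (by linarith : (1 : ℝ) ≤ 1 + y)
  linarith

theorem ffun_gfun (y : ℝ) (hy : 0 ≤ y) : ffun (gfun y) = y := by
  unfold ffun gfun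
  rw [show 2 * (Real.logb 2 (1 + y) / 2) = Real.logb 2 (1 + y) by ring,
    Real.rpow_logb (by norm_num) (by norm_num) (by linarith)]
  ring

/-- given optimal source rates `r*`, the relay rate policy `r̃` defined by
the water-filling recursion is optimal for the two-hop inner problem. -/
theorem twohop_inner_relay_waterfilling_optimal
    (N : ℕ) (hN : 1 ≤ N)
    (E Et Ebar δ : ℕ → ℝ)
    (hE : ∀ i ∈ Finset.Icc 1 N, 0 ≤ E i)
    (hEt : ∀ i ∈ Finset.Icc 1 N, 0 ≤ Et i)
    (hEbar : ∀ i ∈ Finset.Icc 1 N, 0 ≤ Ebar i)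
    (hδ : ∀ i ∈ Finset.Icc 1 N, 0 ≤ δ i)
    (hδEt : ∀ k ∈ Finset.Icc 1 N,
        ∑ i ∈ Finset.Icc 1 k, δ i ≤ ∑ i ∈ Finset.Icc 1 k, Et i)
    (φ ψ : ℝ → ℝ)
    (hphi_cont : ContinuousOn φ (Set.Ici 0))
    (hphi_mono : StrictMonoOn φ (Set.Ici 0))
    (hphi_conv : StrictConvexOn ℝ (Set.Ici 0) φ)
    (hphi0 : φ 0 = 0)
    (hphi_nonneg : ∀ x : ℝ, 0 ≤ x → 0 ≤ φ x)
    (hphi_surj : ∀ y : ℝ, 0 ≤ y → ∃ x : ℝ, 0 ≤ x ∧ φ x = y)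
    (hpsi_left : ∀ x : ℝ, 0 ≤ x → ψ (φ x) = x)
    (hpsi_right : ∀ y : ℝ, 0 ≤ y → φ (ψ y) = y)
    (hpsi_nonneg : ∀ y : ℝ, 0 ≤ y → 0 ≤ ψ y)
    (rstar : ℕ → ℝ)
    (hrs_feas : SUFeasible N E δ φ rstar)
    (hrs_opt : ∀ r : ℕ → ℝ, SUFeasible N E δ φ r →
        ∑ i ∈ Finset.Icc 1 N, r i ≤ ∑ i ∈ Finset.Icc 1 N, rstar i)
    (rt : ℕ → ℝ)
    (hrec : ∃ (M : ℕ) (idx : ℕ → ℕ),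
        idx 0 = 0 ∧ idx M = N ∧ (∀ n < M, idx n < idx (n + 1)) ∧
        ∀ n : ℕ, 1 ≤ n → n ≤ M →
          (∀ i : ℕ, idx (n - 1) < i → i ≤ N →
              vval3 Et δ Ebar φ ψ rstar rt (idx (n - 1)) (idx n) ≤
                vval3 Et δ Ebar φ ψ rstar rt (idx (n - 1)) i) ∧
          (∀ j : ℕ, idx (n - 1) < j → j ≤ idx n →
              rt j = vval3 Et δ Ebar φ ψ rstar rt (idx (n - 1)) (idx n))) :
    InnerFeasible N E Et Ebar δ φ rstar rt ∧
    (∀ r' rt' : ℕ → ℝ, InnerFeasible N E Et Ebar δ φ r' rt' →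
        ∑ i ∈ Finset.Icc 1 N, rt' i ≤ ∑ i ∈ Finset.Icc 1 N, rt i) := by
  have hφ : GoodCost_s7 φ := ⟨hphi_cont, hphi_mono, hphi_conv, hphi0⟩
  obtain ⟨M, idx, h0, hM, hidx, hstep⟩ := hrec
  have W := waterfill (ι := Fin 3) N ![ffun, φ, fun x => x]
    ![fun i => ∑ j ∈ Icc 1 i, (Et j - δ j), fun i => ∑ j ∈ Icc 1 i, Ebar j,
      fun i => ∑ j ∈ Icc 1 i, rstar j] rt
    (by simp [Fin.forall_fin_succ, goodCost_ffun_s7.zero, hphi0])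
    (by
      simp only [Fin.forall_fin_succ]
      exact ⟨fun x hx => goodCost_ffun_s7.nonneg hx, fun x hx => hφ.nonneg hx,
        fun x hx => hx, fun a => a.elim0⟩)
    (by
      simp only [Fin.forall_fin_succ]
      refine ⟨fun i h1 h2 => ?_, fun i h1 h2 => ?_, fun i h1 h2 => ?_, fun a => a.elim0⟩
      · have := hδEt i (mem_Icc.2 ⟨h1, h2⟩)
        simp only [Matrix.cons_val_zero, sum_sub_distrib]
        linarith
      · change 0 ≤ ∑ j ∈ Icc 1 i, Ebar j
        exact sum_nonneg fun j hj => hEbar j (by rw [mem_Icc] at *; omega)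
      · change 0 ≤ ∑ j ∈ Icc 1 i, rstar j
        exact sum_nonneg fun j hj => hrs_feas.1 j (by rw [mem_Icc] at *; omega))
    M idx h0 hM hidx (fun m i => vval3 Et δ Ebar φ ψ rstar rt m i)
    (by
      intro m i hmi hiN hrem
      have hd : (0 : ℝ) < (i : ℝ) - m := by
        have : (m : ℝ) < i := by exact_mod_cast hmi
        linarith
      obtain ⟨p1, q1⟩ := level_iff goodCost_ffun_s7.mono gfun_nonneg ffun_gfun hd (hrem 0)
      obtain ⟨p2, q2⟩ := level_iff hφ.mono hpsi_nonneg hpsi_right hd (hrem 1)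
      obtain ⟨p3, q3⟩ := level_iff (c := fun x => x) (h := fun x => x)
        (fun x _ y _ h => h) (fun y hy => hy) (fun y _ => rfl) hd (hrem 2)
      constructor
      · intro v hv
        simp only [Fin.forall_fin_succ]
        unfold vval3
        rw [le_min_iff, le_min_iff]
        have r1 := p1 v hv
        have r2 := p2 v hv
        have r3 := p3 v hv
        constructor
        · rintro ⟨⟨s1, s2⟩, s3⟩
          exact ⟨r1.1 s1, r2.1 s2, r3.1 s3, fun a => a.elim0⟩
        · rintro ⟨s1, s2, s3, -⟩
          exact ⟨⟨r1.2 s1, r2.2 s2⟩, r3.2 s3⟩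
      · unfold vval3
        rcases min_choice (min
          (gfun ((∑ j ∈ Finset.Icc 1 i, (Et j - δ j) - ∑ j ∈ Finset.Icc 1 m, ffun (rt j)) /
            ((i : ℝ) - (m : ℝ))))
          (ψ ((∑ j ∈ Finset.Icc 1 i, Ebar j - ∑ j ∈ Finset.Icc 1 m, φ (rt j)) /
            ((i : ℝ) - (m : ℝ)))))
          ((∑ j ∈ Finset.Icc 1 i, rstar j - ∑ j ∈ Finset.Icc 1 m, rt j) /
            ((i : ℝ) - (m : ℝ))) with h | h
        · rw [h]
          rcases min_choice
            (gfun ((∑ j ∈ Finset.Icc 1 i, (Et j - δ j) - ∑ j ∈ Finset.Icc 1 m, ffun (rt j)) /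
              ((i : ℝ) - (m : ℝ))))
            (ψ ((∑ j ∈ Finset.Icc 1 i, Ebar j - ∑ j ∈ Finset.Icc 1 m, φ (rt j)) /
              ((i : ℝ) - (m : ℝ)))) with h' | h'
          · rw [h']; exact ⟨0, q1⟩
          · rw [h']; exact ⟨1, q2⟩
        · rw [h]; exact ⟨2, q3⟩)
    (fun n hn i h1 h2 => by
      have := (hstep (n + 1) (by omega) (by omega)).1 i
      simp only [Nat.add_sub_cancel] at this
      exact this h1 h2)
    (fun n hn j h1 h2 => by
      have := (hstep (n + 1) (by omega) (by omega)).2 j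
      simp only [Nat.add_sub_cancel] at this
      exact this h1 h2)
  obtain ⟨w1, w2, w3, w4⟩ := W
  have f1 : ∀ k, 1 ≤ k → k ≤ N →
      ∑ j ∈ Icc 1 k, ffun (rt j) ≤ ∑ j ∈ Icc 1 k, (Et j - δ j) := w3 0
  have f2 : ∀ k, 1 ≤ k → k ≤ N →
      ∑ j ∈ Icc 1 k, φ (rt j) ≤ ∑ j ∈ Icc 1 k, Ebar j := w3 1
  have f3 : ∀ k, 1 ≤ k → k ≤ N →
      ∑ j ∈ Icc 1 k, rt j ≤ ∑ j ∈ Icc 1 k, rstar j := w3 2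
  refine ⟨⟨hrs_feas.1, fun i hi => w1 i (mem_Icc.1 hi).1 (mem_Icc.1 hi).2, hrs_feas.2.1,
    hrs_feas.2.2, fun i hi => f1 i (mem_Icc.1 hi).1 (mem_Icc.1 hi).2,
    fun i hi => f3 i (mem_Icc.1 hi).1 (mem_Icc.1 hi).2,
    fun i hi => f2 i (mem_Icc.1 hi).1 (mem_Icc.1 hi).2⟩, ?_⟩
  rintro r' rt' ⟨g1, g2, g3, g4, g5, g6, g7⟩
  have hdom := su_dominates N E δ φ hφ rstar hrs_feas hrs_opt r' ⟨g1, g3, g4⟩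
  refine compare_main N rt rt' w2 w1 (fun i a b => g2 i (mem_Icc.2 ⟨a, b⟩)) ?_ N hN le_rfl
    (Or.inl rfl)
  intro i h1 h2 h3
  have hmem : i ∈ Icc 1 N := mem_Icc.2 ⟨h1, h2⟩
  obtain ⟨a, ha⟩ := w4 i h1 h2 h3
  fin_cases a
  · right
    refine ⟨ffun, goodCost_ffun_s7, (g5 i hmem).trans (le_of_eq ?_)⟩
    exact ha.symm
  · right
    refine ⟨φ, hφ, (g7 i hmem).trans (le_of_eq ?_)⟩
    exact ha.symm
  · left
    have ha : ∑ j ∈ Icc 1 i, rt j = ∑ j ∈ Icc 1 i, rstar j := ha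
    rw [ha]
    refine (g6 i hmem).trans (hdom i h1 h2 ?_)
    by_cases hiN : i = N
    · exact Or.inl hiN
    · right
      have hlt := h3.resolve_left hiN
      have e1 := f3 (i + 1) (by omega) (by omega)
      rw [sum_Icc_succ_top (by omega), sum_Icc_succ_top (by omega), ha] at e1
      obtain ⟨m, rfl⟩ : ∃ m, i = m + 1 := ⟨i - 1, by omega⟩
      have e2 : ∑ j ∈ Icc 1 m, rt j ≤ ∑ j ∈ Icc 1 m, rstar j := by
        rcases Nat.eq_zero_or_pos m with hm | hm
        · subst hm; simp
        · exact f3 m hm (by omega)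
      rw [sum_Icc_succ_top (by omega), sum_Icc_succ_top (by omega)] at ha
      linarith
end
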